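/- As k → (1/√2)⁺, the ratio (k − 1/√2)/(1 − φ(k))² converges to K(1/√2)²/(8√2), where K(1/√2) = ∫₀¹ dt/√((1−t²)(1−t²/2)). -/

import Mathlib

open Real Filter Set

/-- Complete elliptic integral of the first kind. -/
noncomputable def Kell (k : ℝ) : ℝ :=
  ∫ t in (0:ℝ)..1, 1 / Real.sqrt ((1 - t^2) * (1 - k^2 * t^2))

/-- S(k) = 4√(2k²−1)·K(k). -/
noncomputable def Sfun (k : ℝ) : ℝ := 4 * Real.sqrt (2 * k^2 - 1) * Kell k

/-- H(k), the numerator in the definition of φ. -/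
noncomputable def Hfun (k : ℝ) : ℝ :=
  ∫ t in Real.sqrt ((2 * k^2 - 1) / k^2)..1,
    1 / Real.sqrt ((1 - t^2) * (1 - k^2 * (1 - t^2)))

/-- φ(k) = H(k)/K(k). -/
noncomputable def phiFun (k : ℝ) : ℝ := Hfun k / Kell k

/-- ξ_n = 2|αn − ⌊αn + 1/2⌋|. -/
noncomputable def xiSeq (α : ℝ) (n : ℕ) : ℝ :=
  2 * |α * n - (⌊α * n + 1/2⌋ : ℝ)|

lemma sin_image_Ioo : Real.sin '' Ioo 0 (π / 2) = Ioo 0 1 := by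
  ext y
  constructor
  · rintro ⟨x, ⟨h0, h1⟩, rfl⟩
    refine ⟨Real.sin_pos_of_pos_of_lt_pi h0 (by linarith [pi_pos]), ?_⟩
    rw [← Real.sin_pi_div_two]
    exact Real.sin_lt_sin_of_lt_of_le_pi_div_two (by linarith [pi_pos]) le_rfl h1
  · rintro ⟨h0, h1⟩
    exact ⟨Real.arcsin y, ⟨Real.arcsin_pos.2 h0, Real.arcsin_lt_pi_div_two.2 h1⟩,
      Real.sin_arcsin (by linarith) h1.le⟩

lemma cos_image_Ioo : Real.cos '' Ioo 0 (π / 2) = Ioo 0 1 := by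
  ext y
  constructor
  · rintro ⟨x, ⟨h0, h1⟩, rfl⟩
    refine ⟨Real.cos_pos_of_mem_Ioo ⟨by linarith, h1⟩, ?_⟩
    rw [← Real.cos_zero]
    exact Real.cos_lt_cos_of_nonneg_of_le_pi_div_two le_rfl h1.le h0
  · rintro ⟨h0, h1⟩
    exact ⟨Real.arccos y, ⟨Real.arccos_pos.2 h1, Real.arccos_lt_pi_div_two.2 h0⟩,
      Real.cos_arccos (by linarith) h1.le⟩

lemma injOn_sin_Ioo : InjOn Real.sin (Ioo 0 (π / 2)) :=
  Real.injOn_sin.mono (Ioo_subset_Icc_self.trans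
    (Icc_subset_Icc_left (by linarith [pi_pos])))

lemma injOn_cos_Ioo : InjOn Real.cos (Ioo 0 (π / 2)) :=
  Real.injOn_cos.mono (Ioo_subset_Icc_self.trans
    (Icc_subset_Icc_right (by linarith [pi_pos])))

lemma mul_one_div_sqrt_sq_mul {c x : ℝ} (hc : 0 < c) :
    c * (1 / √(c ^ 2 * x)) = 1 / √x := by
  rw [Real.sqrt_mul (sq_nonneg c), Real.sqrt_sq hc.le]
  field_simp

lemma Kell_eq_integral_sin (k : ℝ) :
    Kell k = ∫ θ in (0 : ℝ)..(π / 2), 1 / √(1 - k ^ 2 * Real.sin θ ^ 2) := by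
  have hpi : (0 : ℝ) ≤ π / 2 := by positivity
  rw [Kell, intervalIntegral.integral_of_le zero_le_one, intervalIntegral.integral_of_le hpi,
    MeasureTheory.integral_Ioc_eq_integral_Ioo, MeasureTheory.integral_Ioc_eq_integral_Ioo,
    ← sin_image_Ioo, MeasureTheory.integral_image_eq_integral_abs_deriv_smul measurableSet_Ioo
      (fun x _ => (Real.hasDerivAt_sin x).hasDerivWithinAt)
      injOn_sin_Ioo]
  refine MeasureTheory.setIntegral_congr_fun measurableSet_Ioo fun θ hθ => ?_
  have hc : 0 < Real.cos θ := Real.cos_pos_of_mem_Ioo ⟨by linarith [hθ.1], hθ.2⟩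
  simp only [smul_eq_mul, ← Real.cos_sq', abs_of_pos hc]
  exact mul_one_div_sqrt_sq_mul hc

lemma one_sub_sq_mul_sin_sq_pos {k : ℝ} (hk : k ^ 2 < 1) (θ : ℝ) :
    0 < 1 - k ^ 2 * Real.sin θ ^ 2 := by
  nlinarith [Real.sin_sq_le_one θ, sq_nonneg k]

lemma continuous_one_div_sqrt_one_sub_sin {k : ℝ} (hk : k ^ 2 < 1) :
    Continuous fun θ : ℝ => 1 / √(1 - k ^ 2 * Real.sin θ ^ 2) :=
  continuous_const.div (by fun_prop)
    fun θ => (Real.sqrt_pos.2 (one_sub_sq_mul_sin_sq_pos hk θ)).ne'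

lemma abs_sin_smul_one_div_sqrt (k : ℝ) {θ : ℝ} (hθ : θ ∈ Ioo 0 (π / 2)) :
    |-Real.sin θ| • (1 / √((1 - Real.cos θ ^ 2) * (1 - k ^ 2 * (1 - Real.cos θ ^ 2)))) =
      1 / √(1 - k ^ 2 * Real.sin θ ^ 2) := by
  have hs : 0 < Real.sin θ := Real.sin_pos_of_pos_of_lt_pi hθ.1 (by linarith [hθ.2, pi_pos])
  simp only [smul_eq_mul, ← Real.sin_sq, abs_neg, abs_of_pos hs]
  exact mul_one_div_sqrt_sq_mul hs

/-- The substitution `t ↦ √(1 - t²)` in the complete elliptic integral. -/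
lemma Kell_eq_integral_compl (k : ℝ) :
    Kell k = ∫ t in (0 : ℝ)..1, 1 / √((1 - t ^ 2) * (1 - k ^ 2 * (1 - t ^ 2))) := by
  have hpi : (0 : ℝ) ≤ π / 2 := by positivity
  rw [Kell_eq_integral_sin, intervalIntegral.integral_of_le zero_le_one,
    intervalIntegral.integral_of_le hpi,
    MeasureTheory.integral_Ioc_eq_integral_Ioo, MeasureTheory.integral_Ioc_eq_integral_Ioo,
    ← cos_image_Ioo, MeasureTheory.integral_image_eq_integral_abs_deriv_smul measurableSet_Ioo
      (fun x _ => (Real.hasDerivAt_cos x).hasDerivWithinAt)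
      injOn_cos_Ioo]
  exact MeasureTheory.setIntegral_congr_fun measurableSet_Ioo fun θ hθ =>
    (abs_sin_smul_one_div_sqrt k hθ).symm

lemma intervalIntegrable_compl {k : ℝ} (hk : k ^ 2 < 1) :
    IntervalIntegrable (fun t : ℝ => 1 / √((1 - t ^ 2) * (1 - k ^ 2 * (1 - t ^ 2))))
      MeasureTheory.volume 0 1 := by
  have hpi : (0 : ℝ) ≤ π / 2 := by positivity
  rw [intervalIntegrable_iff_integrableOn_Ioo_of_le zero_le_one, ← cos_image_Ioo,
    MeasureTheory.integrableOn_image_iff_integrableOn_abs_deriv_smul measurableSet_Ioo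
      (fun x _ => (Real.hasDerivAt_cos x).hasDerivWithinAt)
      injOn_cos_Ioo,
    MeasureTheory.integrableOn_congr_fun (fun θ hθ => abs_sin_smul_one_div_sqrt k hθ)
      measurableSet_Ioo, ← intervalIntegrable_iff_integrableOn_Ioo_of_le hpi]
  exact (continuous_one_div_sqrt_one_sub_sin hk).intervalIntegrable _ _

lemma Kell_pos {k : ℝ} (hk : k ^ 2 < 1) : 0 < Kell k := by
  rw [Kell_eq_integral_sin]
  exact intervalIntegral.intervalIntegral_pos_of_pos
    ((continuous_one_div_sqrt_one_sub_sin hk).intervalIntegrable _ _)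
    (fun θ => one_div_pos.2 (Real.sqrt_pos.2 (one_sub_sq_mul_sin_sq_pos hk θ))) (by positivity)

lemma continuousAt_Kell {c : ℝ} (hc : c ^ 2 < 1) : ContinuousAt Kell c := by
  rw [funext Kell_eq_integral_sin]
  obtain ⟨q, hcq, hq⟩ := exists_between hc
  have hev : ∀ᶠ k : ℝ in nhds c, k ^ 2 < q :=
    (continuous_pow 2).continuousAt.eventually_lt continuousAt_const hcq
  refine intervalIntegral.continuousAt_of_dominated_interval
    (bound := fun _ => 1 / √(1 - q)) ?_ ?_ (by simp) ?_
  · filter_upwards [hev] with k hk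
    exact (continuous_one_div_sqrt_one_sub_sin (hk.trans hq)).aestronglyMeasurable
  · filter_upwards [hev] with k hk
    refine MeasureTheory.ae_of_all _ fun θ _ => ?_
    rw [Real.norm_of_nonneg (by positivity)]
    have := Real.sqrt_pos.2 (sub_pos.2 hq)
    gcongr
    nlinarith [Real.sin_sq_le_one θ, sq_nonneg k]
  · refine MeasureTheory.ae_of_all _ fun θ _ => ?_
    exact continuousAt_const.div (by fun_prop)
      (Real.sqrt_pos.2 (one_sub_sq_mul_sin_sq_pos hc θ)).ne'

lemma Kell_sub_Hfun {k : ℝ} (hk : k ^ 2 < 1) (h2 : 1 ≤ 2 * k ^ 2) :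
    Kell k - Hfun k = ∫ t in (0 : ℝ)..√((2 * k ^ 2 - 1) / k ^ 2),
      1 / √((1 - t ^ 2) * (1 - k ^ 2 * (1 - t ^ 2))) := by
  have ha : √((2 * k ^ 2 - 1) / k ^ 2) ∈ uIcc (0 : ℝ) 1 := by
    rw [uIcc_of_le zero_le_one]
    refine ⟨Real.sqrt_nonneg _, Real.sqrt_le_one.2 ?_⟩
    rw [div_le_one (by linarith)]
    linarith
  have hi := intervalIntegrable_compl hk
  rw [Kell_eq_integral_compl, Hfun, sub_eq_iff_eq_add,
    intervalIntegral.integral_add_adjacent_intervals]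
  · exact hi.mono_set (uIcc_subset_uIcc left_mem_uIcc ha)
  · exact hi.mono_set (uIcc_subset_uIcc ha right_mem_uIcc)

/-- Two-sided bound for `Kell k - Hfun k`, with `x = a²` and `a` the lower limit in `Hfun`. -/
lemma Kell_sub_Hfun_sq_bounds {k x : ℝ} (hk : k ^ 2 < 1) (h2 : 1 ≤ 2 * k ^ 2)
    (hx : x = (2 * k ^ 2 - 1) / k ^ 2) :
    x / (1 - k ^ 2 + k ^ 2 * x ^ 2) ≤ (Kell k - Hfun k) ^ 2 ∧
      (Kell k - Hfun k) ^ 2 ≤ x / (1 - k ^ 2) := by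
  have hk0 : 0 < k ^ 2 := by linarith
  have hx0 : 0 ≤ x := hx ▸ div_nonneg (by linarith) hk0.le
  have hkx : k ^ 2 * x = 2 * k ^ 2 - 1 := by rw [hx]; exact mul_div_cancel₀ _ hk0.ne'
  have hx1 : x ≤ 1 := by nlinarith
  have hpos : 0 < 1 - k ^ 2 := by linarith
  have hpos' : 0 < 1 - k ^ 2 + k ^ 2 * x ^ 2 := by positivity
  have hD := Kell_sub_Hfun hk h2
  rw [← hx] at hD
  have hi : IntervalIntegrable (fun t : ℝ => 1 / √((1 - t ^ 2) * (1 - k ^ 2 * (1 - t ^ 2))))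
      MeasureTheory.volume 0 √x :=
    (intervalIntegrable_compl hk).mono_set (uIcc_subset_uIcc left_mem_uIcc (by
      rw [uIcc_of_le zero_le_one]; exact ⟨Real.sqrt_nonneg _, Real.sqrt_le_one.2 hx1⟩))
  have key : ∀ t ∈ Icc 0 √x, 1 - k ^ 2 ≤ (1 - t ^ 2) * (1 - k ^ 2 * (1 - t ^ 2)) ∧
      (1 - t ^ 2) * (1 - k ^ 2 * (1 - t ^ 2)) ≤ 1 - k ^ 2 + k ^ 2 * x ^ 2 := by
    intro t ht
    have htx : t ^ 2 ≤ x := (Real.le_sqrt ht.1 hx0).1 ht.2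
    have e : (1 - t ^ 2) * (1 - k ^ 2 * (1 - t ^ 2)) =
        1 - k ^ 2 + k ^ 2 * (t ^ 2 * (x - t ^ 2)) := by linear_combination -t ^ 2 * hkx
    have h1 : 0 ≤ t ^ 2 * (x - t ^ 2) := mul_nonneg (sq_nonneg t) (by linarith)
    have h2 : t ^ 2 * (x - t ^ 2) ≤ x ^ 2 := by nlinarith [sq_nonneg t]
    rw [e]
    exact ⟨le_add_of_nonneg_right (by positivity), by gcongr⟩
  have lower : √x * (1 / √(1 - k ^ 2 + k ^ 2 * x ^ 2)) ≤ Kell k - Hfun k := by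
    have := intervalIntegral.integral_mono_on (Real.sqrt_nonneg x)
      (intervalIntegrable_const (c := 1 / √(1 - k ^ 2 + k ^ 2 * x ^ 2))) hi (fun t ht => by
        have h := key t ht
        have := Real.sqrt_pos.2 (hpos.trans_le h.1)
        gcongr
        exact h.2)
    simpa [hD] using this
  have upper : Kell k - Hfun k ≤ √x * (1 / √(1 - k ^ 2)) := by
    have := intervalIntegral.integral_mono_on (Real.sqrt_nonneg x) hi
      (intervalIntegrable_const (c := 1 / √(1 - k ^ 2))) (fun t ht => by
        have h := key t ht
        have := Real.sqrt_pos.2 hpos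
        gcongr
        exact h.1)
    simpa [hD] using this
  have h0 : 0 ≤ √x * (1 / √(1 - k ^ 2 + k ^ 2 * x ^ 2)) := by positivity
  constructor
  · calc x / (1 - k ^ 2 + k ^ 2 * x ^ 2) = (√x * (1 / √(1 - k ^ 2 + k ^ 2 * x ^ 2))) ^ 2 := by
          rw [mul_pow, div_pow, Real.sq_sqrt hx0, Real.sq_sqrt hpos'.le]; ring
      _ ≤ _ := by gcongr
  · calc (Kell k - Hfun k) ^ 2 ≤ (√x * (1 / √(1 - k ^ 2))) ^ 2 := by
          have := h0.trans lower
          gcongr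
      _ = _ := by rw [mul_pow, div_pow, Real.sq_sqrt hx0, Real.sq_sqrt hpos.le]; ring

/-- (k − 1/√2)/(1 − φ(k))² → K(1/√2)²/(8√2) as k → (1/√2)⁺. -/
theorem stmt_13 :
    Filter.Tendsto (fun k => (k - 1 / Real.sqrt 2) / (1 - phiFun k) ^ 2)
      (nhdsWithin (1 / Real.sqrt 2) (Set.Ioo (1 / Real.sqrt 2) 1))
      (nhds (Kell (1 / Real.sqrt 2) ^ 2 / (8 * Real.sqrt 2))) := by
  have hs : 0 < √2 := by positivity
  have hs2 : √2 ^ 2 = 2 := Real.sq_sqrt (by norm_num)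
  set c : ℝ := 1 / √2 with hc
  have hc0 : 0 < c := by positivity
  have hc2 : c ^ 2 = 1 / 2 := by rw [hc, div_pow, hs2]; norm_num
  have hK : Tendsto (fun k => Kell k ^ 2) (nhdsWithin c (Ioo c 1)) (nhds (Kell c ^ 2)) :=
    ((continuousAt_Kell (by rw [hc2]; norm_num)).pow 2).mono_left nhdsWithin_le_nhds
  have hval : c ^ 2 * (1 / 2) / (2 * (c + c)) = 1 / (8 * √2) := by
    rw [hc2, hc]
    field_simp
    linarith
  have hL : Tendsto (fun k => Kell k ^ 2 * (k ^ 2 * (1 - k ^ 2) / (2 * (k + c))))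
      (nhdsWithin c (Ioo c 1)) (nhds (Kell c ^ 2 / (8 * √2))) := by
    have h : ContinuousAt (fun k : ℝ => k ^ 2 * (1 - k ^ 2) / (2 * (k + c))) c :=
      ContinuousAt.div (by fun_prop) (by fun_prop) (by positivity)
    have h' := hK.mul (h.tendsto.mono_left nhdsWithin_le_nhds)
    rwa [show 1 - c ^ 2 = 1 / 2 by rw [hc2]; norm_num, hval, mul_one_div] at h'
  have hU : Tendsto (fun k => Kell k ^ 2 *
      (k ^ 2 * (1 - k ^ 2 + k ^ 2 * ((2 * k ^ 2 - 1) / k ^ 2) ^ 2) / (2 * (k + c))))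
      (nhdsWithin c (Ioo c 1)) (nhds (Kell c ^ 2 / (8 * √2))) := by
    have h : ContinuousAt (fun k : ℝ =>
        k ^ 2 * (1 - k ^ 2 + k ^ 2 * ((2 * k ^ 2 - 1) / k ^ 2) ^ 2) / (2 * (k + c))) c := by
      have : ContinuousAt (fun k : ℝ => (2 * k ^ 2 - 1) / k ^ 2) c :=
        ContinuousAt.div (by fun_prop) (by fun_prop) (by positivity)
      exact ContinuousAt.div (by fun_prop) (by fun_prop) (by positivity)
    have h' := hK.mul (h.tendsto.mono_left nhdsWithin_le_nhds)
    rwa [show 1 - c ^ 2 + c ^ 2 * ((2 * c ^ 2 - 1) / c ^ 2) ^ 2 = 1 / 2 by rw [hc2]; norm_num,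
      hval, mul_one_div] at h'
  have bounds : ∀ k ∈ Ioo c 1,
      Kell k ^ 2 * (k ^ 2 * (1 - k ^ 2) / (2 * (k + c))) ≤ (k - c) / (1 - phiFun k) ^ 2 ∧
      (k - c) / (1 - phiFun k) ^ 2 ≤ Kell k ^ 2 *
        (k ^ 2 * (1 - k ^ 2 + k ^ 2 * ((2 * k ^ 2 - 1) / k ^ 2) ^ 2) / (2 * (k + c))) := by
    rintro k ⟨hck, hk1⟩
    have hk0 : 0 < k := hc0.trans hck
    have hk : k ^ 2 < 1 := by nlinarith
    have hd : 0 < k - c := sub_pos.2 hck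
    have hfac : 2 * k ^ 2 - 1 = 2 * (k - c) * (k + c) := by linear_combination 2 * hc2
    have h2 : 0 < 2 * k ^ 2 - 1 := by rw [hfac]; positivity
    obtain ⟨hlo, hup⟩ := Kell_sub_Hfun_sq_bounds hk (by linarith) rfl
    set x := (2 * k ^ 2 - 1) / k ^ 2 with hx
    have hx0 : 0 < x := by positivity
    have hq : 0 < 1 - k ^ 2 := by linarith
    have hq' : 0 < 1 - k ^ 2 + k ^ 2 * x ^ 2 := by positivity
    have hKp := Kell_pos hk
    have hD : 0 < (Kell k - Hfun k) ^ 2 := lt_of_lt_of_le (by positivity) hlo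
    have hdx : k - c = x * k ^ 2 / (2 * (k + c)) := by
      rw [hx, hfac]
      field_simp
    have hrat : (k - c) / (1 - phiFun k) ^ 2 =
        Kell k ^ 2 * (k ^ 2 * (x / (Kell k - Hfun k) ^ 2) / (2 * (k + c))) := by
      rw [phiFun, one_sub_div hKp.ne', div_pow, hdx]
      field_simp
    rw [hrat]
    have h1 : 1 - k ^ 2 ≤ x / (Kell k - Hfun k) ^ 2 := by
      rwa [le_div_iff₀ hD, mul_comm, ← le_div_iff₀ hq]
    have h3 : x / (Kell k - Hfun k) ^ 2 ≤ 1 - k ^ 2 + k ^ 2 * x ^ 2 := by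
      rwa [div_le_iff₀ hD, mul_comm, ← div_le_iff₀ hq']
    constructor <;> gcongr
  exact tendsto_of_tendsto_of_tendsto_of_le_of_le' hL hU
    (eventually_nhdsWithin_of_forall fun k hk => (bounds k hk).1)
    (eventually_nhdsWithin_of_forall fun k hk => (bounds k hk).2)
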